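/- Let C be a Galoisien category, let E be a Gysin functor on C, and let X be an atomic Galois object of C. Then the map from the twisted group ring E(X)[Ãut(X)] to the endomorphism ring C_E(X, X), sending a[f] to Da ∘ Rf, is an isomorphism of rings. Here E(X)[Ãut(X)] is the free E(X)-module on the set Aut_C(X), with multiplication determined by a[f] · b[g] = (a · ((f^{-1})^*b))[f ∘ g]. -/

import Mathlib

open CategoryTheory CategoryTheory.Limits

universe v u

/-- A Gysin functor on a finitary lextensive category `C`. -/
structure GysinFunctor (C : Type u) [Category.{v} C] [HasFiniteLimits C]
    [HasFiniteCoproducts C] [FinitaryExtensive C] where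
  /-- The underlying rings. -/
  E : C → Type v
  commRing : ∀ X : C, CommRing (E X)
  /-- Contravariant functoriality (pullback), by ring maps. -/
  pull : ∀ {X Y : C}, (X ⟶ Y) → (E Y →+* E X)
  pull_id : ∀ X : C, pull (𝟙 X) = RingHom.id (E X)
  pull_comp : ∀ {X Y Z : C} (f : X ⟶ Y) (g : Y ⟶ Z),
    pull (f ≫ g) = (pull f).comp (pull g)
  /-- Covariant functoriality (pushforward/Gysin maps), by additive maps. -/
  push : ∀ {X Y : C}, (X ⟶ Y) → (E X →+ E Y)
  push_id : ∀ X : C, push (𝟙 X) = AddMonoidHom.id (E X)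
  push_comp : ∀ {X Y Z : C} (f : X ⟶ Y) (g : Y ⟶ Z),
    push (f ≫ g) = (push g).comp (push f)
  /-- Zero axiom: `E ∅ = 0`. -/
  zero : Subsingleton (E (⊥_ C))
  /-- Behavior on sums. -/
  coprod_bij : ∀ X Y : C, Function.Bijective
    (fun a : E (X ⨿ Y) => (pull coprod.inl a, pull coprod.inr a))
  /-- Push-product axiom. -/
  push_product : ∀ {X X' Y Y' : C} (f : X ⟶ X') (g : Y ⟶ Y') (a : E X) (b : E Y),
    push (prod.map f g) (pull prod.fst a * pull prod.snd b)
      = pull prod.fst (push f a) * pull prod.snd (push g b)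
  /-- Push-pull axiom. -/
  push_pull : ∀ {A B C' D' : C} (f : A ⟶ B) (p : A ⟶ C') (q : B ⟶ D') (g : C' ⟶ D'),
    IsPullback f p q g → ∀ a : E C', push f (pull p a) = pull q (push g a)

namespace GysinFunctor

attribute [instance] GysinFunctor.commRing

variable {C : Type u} [Category.{v} C] [HasFiniteLimits C]
  [HasFiniteCoproducts C] [FinitaryExtensive C] (G : GysinFunctor C)

/-- Hom-groups of the category of correspondences: `C_E(A, B) = E(B × A)`. -/
noncomputable def Hom (A B : C) : Type v := G.E (B ⨯ A)

noncomputable instance (A B : C) : AddCommGroup (G.Hom A B) :=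
  inferInstanceAs (AddCommGroup (G.E (B ⨯ A)))

/-- Composition in the category of correspondences. -/
noncomputable def comp {A B Cc : C} (β : G.Hom B Cc) (α : G.Hom A B) : G.Hom A Cc :=
  G.push (prod.map prod.fst (𝟙 A) : (Cc ⨯ B) ⨯ A ⟶ Cc ⨯ A)
    (G.pull (prod.fst : (Cc ⨯ B) ⨯ A ⟶ Cc ⨯ B) β *
      G.pull (prod.map prod.snd (𝟙 A) : (Cc ⨯ B) ⨯ A ⟶ B ⨯ A) α)

/-- The identity morphism `i_A = Δ_!(1)` in the category of correspondences. -/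
noncomputable def ident (A : C) : G.Hom A A := G.push (diag A) 1

/-- `Rf`, the forward map associated to `f : A ⟶ B`. -/
noncomputable def Rmor {A B : C} (f : A ⟶ B) : G.Hom A B :=
  G.push (prod.lift f (𝟙 A)) 1

/-- `If`, the transfer map associated to `f : A ⟶ B`. -/
noncomputable def Imor {A B : C} (f : A ⟶ B) : G.Hom B A :=
  G.push (prod.lift (𝟙 A) f) 1

/-- `Da`, the diagonal endomorphism associated to `a ∈ E(A)`. -/
noncomputable def Dmor {A : C} (a : G.E A) : G.Hom A A := G.push (diag A) a

/-- The duality anti-automorphism on hom-groups. -/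
noncomputable def star {A B : C} (α : G.Hom A B) : G.Hom B A :=
  G.pull (prod.braiding A B).hom α

end GysinFunctor

/-- An object is atomic if it is not initial and is not a coproduct of two
non-initial objects. -/
def AtomicObj {C : Type u} [Category.{v} C] [HasFiniteLimits C]
    [HasFiniteCoproducts C] [FinitaryExtensive C] (X : C) : Prop :=
  ¬ Nonempty (IsInitial X) ∧
  ∀ A B : C, Nonempty (X ≅ A ⨿ B) → Nonempty (IsInitial A) ∨ Nonempty (IsInitial B)

/-- A Galoisien category. -/
structure Galoisien (C : Type u) [Category.{v} C] [HasFiniteLimits C]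
    [HasFiniteCoproducts C] [FinitaryExtensive C] : Prop where
  hom_coprod : ∀ X : C, AtomicObj X → ∀ Y Z : C, Function.Bijective
    (Sum.elim (fun f : X ⟶ Y => f ≫ (coprod.inl : Y ⟶ Y ⨿ Z))
      (fun g : X ⟶ Z => g ≫ (coprod.inr : Z ⟶ Y ⨿ Z)))
  aut_finite : ∀ X : C, AtomicObj X → Finite (Aut X)
  no_map_to_initial : ∀ X : C, ¬ Nonempty (IsInitial X) → IsEmpty (X ⟶ (⊥_ C))

/-- An object `Y` is Galois if the maps `(id_Y, σ)` for `σ ∈ Aut(Y)` exhibit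
`Y × Y` as the coproduct of `Aut(Y)` copies of `Y`. -/
def GaloisObj {C : Type u} [Category.{v} C] [HasFiniteLimits C]
    [HasFiniteCoproducts C] [FinitaryExtensive C] (Y : C) : Prop :=
  Nonempty (IsColimit (Cofan.mk (f := fun _ : Aut Y => Y) (Y ⨯ Y)
    (fun σ : Aut Y => prod.lift (𝟙 Y) σ.hom)))

namespace GysinFunctor

variable {C : Type u} [Category.{v} C] [HasFiniteLimits C]
  [HasFiniteCoproducts C] [FinitaryExtensive C] (G : GysinFunctor C)

/-- The map from the twisted group ring `E(X)[Ãut(X)]` (realized as the finitely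
supported functions `Aut(X) →₀ E(X)`) to `C_E(X, X)`, sending `a[f]` to `Da ∘ Rf`. -/
noncomputable def twistedToEnd (X : C) (μ : Aut X →₀ G.E X) : G.Hom X X :=
  μ.sum fun σ a => G.comp (G.Dmor a) (G.Rmor σ.hom)

/-- The multiplication of the twisted group ring `E(X)[Ãut(X)]`, determined by
`a[f] · b[g] = (a · ((f⁻¹)^* b))[f ∘ g]`. -/
noncomputable def twistedMul (X : C) (μ ν : Aut X →₀ G.E X) : Aut X →₀ G.E X :=
  μ.sum fun σ a => ν.sum fun τ b => Finsupp.single (σ * τ) (a * G.pull σ.inv b)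

end GysinFunctor

lemma isPullback_prod_map_diag {C : Type u} [Category.{v} C] [HasFiniteLimits C]
    {A B : C} (f : A ⟶ B) :
    IsPullback f (prod.lift f (𝟙 A)) (diag B) (prod.map (𝟙 B) f) :=
  IsPullback.mk' (by ext <;> simp [prod.lift_fst, prod.lift_snd])
    (fun _ _ _ _ h => by simpa [prod.lift_snd] using h =≫ prod.snd)
    (fun T a b h => by
      have h₁ := h =≫ prod.fst
      have h₂ := h =≫ prod.snd
      simp only [diag, Category.assoc, prod.lift_fst, prod.lift_snd, prod.map_fst, prod.map_snd,
        Category.comp_id] at h₁ h₂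
      refine ⟨b ≫ prod.snd, by simpa using h₂.symm, ?_⟩
      ext <;> simp [prod.lift_fst, prod.lift_snd, ← h₁, ← h₂])

lemma isPullback_lift_id {C : Type u} [Category.{v} C] [HasFiniteLimits C]
    {X Y Z : C} (f : X ⟶ Y) (g : Y ⟶ Z) :
    IsPullback (prod.lift (𝟙 X) (f ≫ g)) f (prod.map f (𝟙 Z)) (prod.lift (𝟙 Y) g) :=
  IsPullback.mk' (by ext <;> simp [prod.lift_fst, prod.lift_snd])
    (fun _ _ _ h _ => by simpa [prod.lift_fst] using h =≫ prod.fst)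
    (fun T a b h => by
      have h₁ := h =≫ prod.fst
      have h₂ := h =≫ prod.snd
      simp only [Category.assoc, prod.lift_fst, prod.lift_snd, prod.map_fst, prod.map_snd,
        Category.comp_id] at h₁ h₂
      refine ⟨a ≫ prod.fst, ?_, by simpa using h₁⟩
      ext <;> simp [prod.lift_fst, prod.lift_snd, h₂, reassoc_of% h₁])

namespace GysinFunctor

variable {C : Type u} [Category.{v} C] [HasFiniteLimits C]
  [HasFiniteCoproducts C] [FinitaryExtensive C] (G : GysinFunctor C)

lemma pull_pull {X Y Z : C} (f : X ⟶ Y) (g : Y ⟶ Z) (a : G.E Z) :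
    G.pull f (G.pull g a) = G.pull (f ≫ g) a := by
  rw [G.pull_comp]; rfl

lemma push_push {X Y Z : C} (f : X ⟶ Y) (g : Y ⟶ Z) (a : G.E X) :
    G.push g (G.push f a) = G.push (f ≫ g) a := by
  rw [G.push_comp]; rfl

@[simp] lemma pull_id_apply {X : C} (a : G.E X) : G.pull (𝟙 X) a = a := by
  rw [G.pull_id]; rfl

@[simp] lemma push_id_apply {X : C} (a : G.E X) : G.push (𝟙 X) a = a := by
  rw [G.push_id]; rfl

/-- The projection formula. -/
lemma mul_push {A B : C} (f : A ⟶ B) (y : G.E B) (x : G.E A) :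
    y * G.push f x = G.push f (G.pull f y * x) := by
  have h := G.push_pull _ _ _ _ (isPullback_prod_map_diag f)
    (G.pull prod.fst y * G.pull prod.snd x)
  rw [G.push_product, push_id_apply, map_mul (G.pull _), map_mul (G.pull _), pull_pull, pull_pull,
    pull_pull, pull_pull] at h
  simpa [diag, prod.lift_fst, prod.lift_snd] using h.symm

lemma push_mul {A B : C} (f : A ⟶ B) (x : G.E A) (y : G.E B) :
    G.push f x * y = G.push f (x * G.pull f y) := by
  rw [mul_comm, mul_push, mul_comm]

lemma push_pull_of_isIso {A B : C} (f : A ⟶ B) [IsIso f] (a : G.E B) :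
    G.push f (G.pull f a) = a := by
  simpa using G.push_pull f f (𝟙 B) (𝟙 B) (.of_vert_isIso ⟨by simp⟩) a

lemma pull_push_of_mono {A B : C} (f : A ⟶ B) [Mono f] (a : G.E A) :
    G.pull f (G.push f a) = a := by
  simpa using (G.push_pull (𝟙 A) (𝟙 A) f f (IsKernelPair.id_of_mono f) a).symm

/-- The correspondence in `C_E(X, X)` given by pushing `a` forward along the graph of `σ`. -/
noncomputable def graphPush {X : C} (σ : X ⟶ X) (a : G.E X) : G.Hom X X :=
  G.push (prod.lift (𝟙 X) σ) a

lemma graphPush_add {X : C} (σ : X ⟶ X) (a b : G.E X) :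
    G.graphPush σ (a + b) = G.graphPush σ a + G.graphPush σ b :=
  map_add _ _ _

lemma graphPush_zero {X : C} (σ : X ⟶ X) : G.graphPush σ (0 : G.E X) = 0 :=
  map_zero _

lemma comp_graphPush {X : C} (σ τ : X ⟶ X) (a b : G.E X) :
    G.comp (G.graphPush σ a) (G.graphPush τ b) = G.graphPush (σ ≫ τ) (a * G.pull σ b) := by
  change G.push _ (G.pull _ (G.push _ a) * G.pull _ (G.push _ b)) = G.push _ _
  rw [← G.push_pull _ _ _ _ (IsPullback.of_prod_fst_with_id (prod.lift (𝟙 X) σ) X).flip,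
    push_mul, push_push, pull_pull, prod.map_map, prod.map_map]
  simp only [prod.lift_fst, prod.lift_snd, Category.comp_id, prod.map_id_id, push_id_apply]
  rw [← G.push_pull _ _ _ _ (isPullback_lift_id σ τ), mul_push, pull_pull,
    prod.lift_fst, pull_id_apply]

lemma Dmor_eq_graphPush {X : C} (a : G.E X) : G.Dmor a = G.graphPush (𝟙 X) a := rfl

lemma Rmor_eq_graphPush {X : C} (σ : Aut X) :
    G.Rmor σ.hom = G.graphPush σ.inv (1 : G.E X) := by
  have : IsIso σ.hom := Iso.isIso_hom σ
  have h : G.push σ.hom (1 : G.E X) = 1 := by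
    simpa using G.push_pull_of_isIso σ.hom (1 : G.E X)
  have h' : σ.hom ≫ prod.lift (𝟙 X) σ.inv = prod.lift σ.hom (𝟙 X) := by
    rw [prod.comp_lift, Category.comp_id, Iso.hom_inv_id σ]
  unfold Rmor graphPush
  rw [← h', ← push_push, h]

lemma Dmor_comp_Rmor {X : C} (a : G.E X) (σ : Aut X) :
    G.comp (G.Dmor a) (G.Rmor σ.hom) = G.graphPush σ.inv a := by
  rw [Dmor_eq_graphPush, Rmor_eq_graphPush, comp_graphPush]
  simp

lemma comp_add {A B D : C} (β : G.Hom B D) (α α' : G.Hom A B) :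
    G.comp β (α + α') = G.comp β α + G.comp β α' := by
  unfold comp
  erw [map_add, mul_add, map_add]
  rfl

lemma add_comp {A B D : C} (β β' : G.Hom B D) (α : G.Hom A B) :
    G.comp (β + β') α = G.comp β α + G.comp β' α := by
  unfold comp
  erw [map_add, add_mul, map_add]
  rfl

/-- Composition in the category of correspondences as a biadditive map. -/
noncomputable def compHom (A B D : C) : G.Hom B D →+ G.Hom A B →+ G.Hom A D :=
  AddMonoidHom.mk' (fun β => AddMonoidHom.mk' (G.comp β) (G.comp_add β))
    (fun β β' => by ext α; exact G.add_comp β β' α)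

lemma twistedToEnd_eq_sum {X : C} (μ : Aut X →₀ G.E X) :
    G.twistedToEnd X μ = μ.sum fun σ a => G.graphPush σ.inv a := by
  unfold twistedToEnd
  simp only [Dmor_comp_Rmor]

lemma twistedToEnd_single {X : C} (σ : Aut X) (a : G.E X) :
    G.twistedToEnd X (Finsupp.single σ a) = G.graphPush σ.inv a := by
  rw [twistedToEnd_eq_sum]
  exact Finsupp.sum_single_index (G.graphPush_zero _)

lemma twistedToEnd_add {X : C} (μ ν : Aut X →₀ G.E X) :
    G.twistedToEnd X (μ + ν) = G.twistedToEnd X μ + G.twistedToEnd X ν := by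
  classical
  simp only [twistedToEnd_eq_sum]
  exact Finsupp.sum_add_index' (fun _ => G.graphPush_zero _) fun _ => G.graphPush_add _

/-- `twistedToEnd` as an additive map. -/
noncomputable def twistedToEndHom (X : C) : (Aut X →₀ G.E X) →+ G.Hom X X :=
  AddMonoidHom.mk' (G.twistedToEnd X) G.twistedToEnd_add

lemma twistedToEnd_twistedMul {X : C} (μ ν : Aut X →₀ G.E X) :
    G.twistedToEnd X (G.twistedMul X μ ν)
      = G.comp (G.twistedToEnd X μ) (G.twistedToEnd X ν) := by
  change G.twistedToEndHom X (G.twistedMul X μ ν)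
    = G.compHom X X X (G.twistedToEnd X μ) (G.twistedToEnd X ν)
  simp only [twistedMul, twistedToEnd_eq_sum, Finsupp.sum, map_sum, AddMonoidHom.finsetSum_apply]
  rw [Finset.sum_comm]
  refine Finset.sum_congr rfl fun σ _ => Finset.sum_congr rfl fun τ _ => ?_
  exact (G.twistedToEnd_single _ _).trans (G.comp_graphPush _ _ _ _).symm

lemma subsingleton_of_isInitial {X : C} (h : IsInitial X) : Subsingleton (G.E X) := by
  have := G.zero
  refine ⟨fun a b => ?_⟩
  rw [← G.push_pull_of_isIso (h.uniqueUpToIso initialIsInitial).inv a,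
    ← G.push_pull_of_isIso (h.uniqueUpToIso initialIsInitial).inv b]
  congr 1
  exact Subsingleton.elim _ _

lemma eq_zero_of_pull_eq_zero_fin {n : ℕ} (f : Fin n → C) (c : Cofan f) (hc : IsColimit c)
    (x : G.E c.pt) (hx : ∀ i, G.pull (c.inj i) x = 0) : x = 0 := by
  induction n with
  | zero =>
    have hI : IsInitial c.pt := IsInitial.ofUniqueHom
      (fun Y => Cofan.IsColimit.desc hc fun i => i.elim0)
      (fun Y m => Cofan.IsColimit.hom_ext hc _ _ fun i => i.elim0)
    have := G.subsingleton_of_isInitial hI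
    exact Subsingleton.elim _ _
  | succ n ih =>
    let c₁ := Cofan.mk _ (Sigma.ι fun i : Fin n => f i.succ)
    have hc₁ : IsColimit c₁ := coproductIsCoproduct _
    let c₂ : BinaryCofan (f 0) c₁.pt := BinaryCofan.mk coprod.inl coprod.inr
    have hc₂ : IsColimit c₂ := coprodIsCoprod _ _
    let e := (extendCofanIsColimit f hc₁ hc₂).coconePointUniqueUpToIso hc
    have he (i) : (extendCofan c₁ c₂).inj i ≫ e.hom = c.inj i :=
      (extendCofanIsColimit f hc₁ hc₂).comp_coconePointUniqueUpToIso_hom hc ⟨i⟩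
    have key : G.pull e.hom x = 0 := by
      apply (G.coprod_bij (f 0) c₁.pt).1
      refine Prod.ext ?_ ?_
      · refine Eq.trans ?_ (map_zero (G.pull coprod.inl)).symm
        rw [← hx 0, ← he 0]
        exact G.pull_pull _ _ _
      · refine Eq.trans ?_ (map_zero (G.pull coprod.inr)).symm
        refine ih _ c₁ hc₁ _ fun i => ?_
        rw [← hx i.succ, ← he i.succ]
        exact (G.pull_pull _ _ _).trans (G.pull_pull _ _ _)
    rw [← G.push_pull_of_isIso e.hom x, key, map_zero]

/-- An element of `E` of a finite coproduct that restricts to zero on every summand is zero. -/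
lemma eq_zero_of_pull_eq_zero {ι : Type*} [Finite ι] {f : ι → C} {c : Cofan f}
    (hc : IsColimit c) (x : G.E c.pt) (hx : ∀ i, G.pull (c.inj i) x = 0) : x = 0 := by
  obtain ⟨n, ⟨e⟩⟩ := Finite.exists_equiv_fin ι
  exact G.eq_zero_of_pull_eq_zero_fin (f ∘ e.symm) _
    (Cofan.isColimitEquivOfEquiv e.symm c hc) x fun i => hx _

lemma pull_push_eq_zero_of_ne {ι : Type*} [Finite ι] {f : ι → C} {c : Cofan f}
    (hc : IsColimit c) {i j : ι} (hij : i ≠ j) (a : G.E (f j)) :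
    G.pull (c.inj i) (G.push (c.inj j) a) = 0 := by
  have := G.zero
  have h := FinitaryExtensive.isPullback_initial_to hc ⟨i⟩ ⟨j⟩ (ne_of_apply_ne Discrete.as hij)
  refine (G.push_pull _ _ _ _ h a).symm.trans ?_
  rw [Subsingleton.elim (G.pull _ a) 0, map_zero]

end GysinFunctor

open GysinFunctor in
/-- For an atomic Galois object `X` of a Galoisien category, the map
`E(X)[Ãut(X)] → C_E(X, X)`, `a[f] ↦ Da ∘ Rf`, is an isomorphism of rings. -/
theorem gysinFunctor_galois_endomorphism_ring
    {C : Type u} [Category.{v} C] [HasFiniteLimits C]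
    [HasFiniteCoproducts C] [FinitaryExtensive C] (G : GysinFunctor C)
    (hC : Galoisien C) (X : C) (hX : AtomicObj X) (hGal : GaloisObj X) :
    Function.Bijective (G.twistedToEnd X) ∧
    (∀ μ ν : Aut X →₀ G.E X,
      G.twistedToEnd X (μ + ν) = G.twistedToEnd X μ + G.twistedToEnd X ν) ∧
    (∀ μ ν : Aut X →₀ G.E X,
      G.twistedToEnd X (G.twistedMul X μ ν)
        = G.comp (G.twistedToEnd X μ) (G.twistedToEnd X ν)) ∧
    G.twistedToEnd X (Finsupp.single (1 : Aut X) (1 : G.E X)) = G.ident X := by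
  refine ⟨?_, G.twistedToEnd_add, G.twistedToEnd_twistedMul, G.twistedToEnd_single 1 1⟩
  classical
  have := hC.aut_finite X hX
  obtain ⟨hc⟩ := hGal
  have pull_graph (σ : Aut X) (μ : Aut X →₀ G.E X) :
      G.pull (prod.lift (𝟙 X) σ.inv) (G.twistedToEnd X μ) = μ σ := by
    induction μ using Finsupp.induction_linear with
    | zero => exact map_zero ((G.pull _).toAddMonoidHom.comp (G.twistedToEndHom X))
    | add μ ν hμ hν =>
      rw [Finsupp.add_apply, ← hμ, ← hν, twistedToEnd_add]
      exact map_add (G.pull _) _ _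
    | single τ a =>
      rw [twistedToEnd_single, Finsupp.single_apply]
      split_ifs with h
      · subst h
        have : IsSplitMono (prod.lift (𝟙 X) τ.inv) := .mk' ⟨prod.fst, prod.lift_fst _ _⟩
        exact G.pull_push_of_mono _ a
      · exact G.pull_push_eq_zero_of_ne hc (i := σ⁻¹) (j := τ⁻¹)
          (fun e => h (inv_injective e).symm) a
  refine ⟨fun μ ν h => Finsupp.ext fun σ => ?_, fun x => ?_⟩
  · rw [← pull_graph, ← pull_graph, h]
  · let μ : Aut X →₀ G.E X := Finsupp.equivFunOnFinite.symm
      fun σ => G.pull (prod.lift (𝟙 X) σ.inv) x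
    refine ⟨μ, sub_eq_zero.1 (G.eq_zero_of_pull_eq_zero hc _ fun σ => ?_)⟩
    refine (map_sub (G.pull _) _ _).trans (sub_eq_zero.2 ?_)
    exact pull_graph σ⁻¹ μ
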